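/- Let 𝒰 and 𝒴 be real separable Banach spaces, μ₀ a Borel probability measure on 𝒰, and Φ : 𝒰 × 𝒴 → ℝ satisfying (A0), (A1) and (A2). Let r > 0 be such that S_{1,2,r} := ∫_𝒰 exp(2·M_{2,r}(‖u‖) − M_{1,r}(‖u‖)) dμ₀(u) < ∞. For y with ‖y‖ < r define Z(y) := ∫_𝒰 exp(−Φ(u;y)) dμ₀(u) and the posterior μ^y by dμ^y/dμ₀(u) = exp(−Φ(u;y))/Z(y). Then there exists a constant C (depending on r, S_{1,2,r}, and the data in (A0)–(A2)) such that for all y, y' ∈ 𝒴 with ‖y‖ < r and ‖y'‖ < r, the Hellinger distance satisfies d_H(μ^y, μ^{y'}) ≤ C·‖y − y'‖. -/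

import Mathlib

open MeasureTheory

/-- The Hellinger distance between two measures, computed with respect to the dominating
measure `λ = μ + ν`: `d_H(μ,ν)² = ∫ (√(dμ/dλ) - √(dν/dλ))² dλ`. -/
noncomputable def hellingerDist {U : Type*} [MeasurableSpace U] (μ ν : Measure U) : ℝ :=
  Real.sqrt (∫ u, (Real.sqrt ((μ.rnDeriv (μ + ν) u).toReal) -
    Real.sqrt ((ν.rnDeriv (μ + ν) u).toReal)) ^ 2 ∂(μ + ν))

/-- The Bayesian posterior for prior `μ₀`, misfit `Φ` and data `y`: the measure with density
`exp(-Φ(u;y)) / Z(y)` with respect to `μ₀`, where `Z(y) = ∫ exp(-Φ(u;y)) dμ₀(u)`. -/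
noncomputable def posteriorMeasure {U Y : Type*} [MeasurableSpace U]
    (μ₀ : Measure U) (Φ : U → Y → ℝ) (y : Y) : Measure U :=
  μ₀.withDensity fun u =>
    ENNReal.ofReal (Real.exp (-Φ u y) / ∫ v, Real.exp (-Φ v y) ∂μ₀)

/-- The Hellinger distance may be computed with respect to any dominating measure. -/
lemma hellingerDist_eq_of_absolutelyContinuous {U : Type*} [MeasurableSpace U]
    {μ ν κ : Measure U} [IsFiniteMeasure μ] [IsFiniteMeasure ν] [SigmaFinite κ]
    (hμ : μ ≪ κ) (hν : ν ≪ κ) :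
    hellingerDist μ ν = Real.sqrt (∫ u, (Real.sqrt ((μ.rnDeriv κ u).toReal) -
      Real.sqrt ((ν.rnDeriv κ u).toReal)) ^ 2 ∂κ) := by
  have hsum : μ + ν ≪ κ := Measure.AbsolutelyContinuous.add_left_iff.mpr ⟨hμ, hν⟩
  have hμs : μ ≪ μ + ν := Measure.AbsolutelyContinuous.rfl.add_right ν
  have hνs : ν ≪ μ + ν := by
    rw [add_comm]; exact Measure.AbsolutelyContinuous.rfl.add_right μ
  unfold hellingerDist
  rw [← integral_rnDeriv_smul hsum]
  congr 1
  refine integral_congr_ae ?_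
  filter_upwards [Measure.rnDeriv_mul_rnDeriv (κ := κ) hμs,
    Measure.rnDeriv_mul_rnDeriv (κ := κ) hνs] with u h₁ h₂
  have hl : 0 ≤ ((μ + ν).rnDeriv κ u).toReal := ENNReal.toReal_nonneg
  rw [← h₁, ← h₂]
  simp only [Pi.mul_apply, ENNReal.toReal_mul, smul_eq_mul]
  rw [Real.sqrt_mul ENNReal.toReal_nonneg, Real.sqrt_mul ENNReal.toReal_nonneg, ← sub_mul,
    mul_pow, Real.sq_sqrt hl, mul_comm]

/-- The Hellinger distance between measures given by integrable real densities. -/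
lemma hellingerDist_withDensity_ofReal {U : Type*} [MeasurableSpace U]
    {κ : Measure U} [SigmaFinite κ] {p q : U → ℝ} (hp : Measurable p) (hq : Measurable q)
    (hp0 : ∀ u, 0 ≤ p u) (hq0 : ∀ u, 0 ≤ q u) (hpi : Integrable p κ) (hqi : Integrable q κ) :
    hellingerDist (κ.withDensity fun u => ENNReal.ofReal (p u))
      (κ.withDensity fun u => ENNReal.ofReal (q u)) =
      Real.sqrt (∫ u, (Real.sqrt (p u) - Real.sqrt (q u)) ^ 2 ∂κ) := by
  have := isFiniteMeasure_withDensity_ofReal hpi.2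
  have := isFiniteMeasure_withDensity_ofReal hqi.2
  rw [hellingerDist_eq_of_absolutelyContinuous (withDensity_absolutelyContinuous κ _)
    (withDensity_absolutelyContinuous κ _)]
  congr 1
  refine integral_congr_ae ?_
  filter_upwards [Measure.rnDeriv_withDensity κ hp.ennreal_ofReal,
    Measure.rnDeriv_withDensity κ hq.ennreal_ofReal] with u h₁ h₂
  rw [h₁, h₂, ENNReal.toReal_ofReal (hp0 u), ENNReal.toReal_ofReal (hq0 u)]

/-- Normalizing two elements `a`, `b` of `L²` expands their distance by a factor of at most
`(‖a‖ ‖b‖)^(-1/2)`. -/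
lemma integral_sq_sub_div_sqrt_le {U : Type*} [MeasurableSpace U] {κ : Measure U} {a b : U → ℝ}
    (ha : MemLp a 2 κ) (hb : MemLp b 2 κ)
    (ha0 : 0 < ∫ u, a u ^ 2 ∂κ) (hb0 : 0 < ∫ u, b u ^ 2 ∂κ) :
    ∫ u, (a u / Real.sqrt (∫ v, a v ^ 2 ∂κ) - b u / Real.sqrt (∫ v, b v ^ 2 ∂κ)) ^ 2 ∂κ ≤
      (∫ u, (a u - b u) ^ 2 ∂κ) /
        (Real.sqrt (∫ v, a v ^ 2 ∂κ) * Real.sqrt (∫ v, b v ^ 2 ∂κ)) := by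
  have hexp (s t : ℝ) : ∫ u, (a u / s - b u / t) ^ 2 ∂κ =
      (∫ u, a u ^ 2 ∂κ) / s ^ 2 + (∫ u, b u ^ 2 ∂κ) / t ^ 2
        - 2 * (∫ u, a u * b u ∂κ) / (s * t) := by
    have h : ∀ u, (a u / s - b u / t) ^ 2 =
        a u ^ 2 / s ^ 2 + b u ^ 2 / t ^ 2 - a u * b u * (2 / (s * t)) := fun u => by
      ring
    simp_rw [h]
    have hab : Integrable (fun u => a u * b u) κ := ha.integrable_mul hb
    have hsum : Integrable (fun u => a u ^ 2 / s ^ 2 + b u ^ 2 / t ^ 2) κ :=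
      (ha.integrable_sq.div_const _).add (hb.integrable_sq.div_const _)
    rw [integral_sub hsum (hab.mul_const _), integral_add (ha.integrable_sq.div_const _)
      (hb.integrable_sq.div_const _), integral_div, integral_div, integral_mul_const]
    ring
  have h₁ := hexp 1 1
  simp only [div_one, one_pow, mul_one] at h₁
  rw [hexp, h₁]
  have hs := Real.sq_sqrt ha0.le
  have ht := Real.sq_sqrt hb0.le
  have hs0 := Real.sqrt_pos.mpr ha0
  have ht0 := Real.sqrt_pos.mpr hb0
  generalize Real.sqrt (∫ v, a v ^ 2 ∂κ) = s at *
  generalize Real.sqrt (∫ v, b v ^ 2 ∂κ) = t at *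
  rw [← hs, ← ht, div_self (by positivity), div_self (by positivity), le_div_iff₀ (by positivity),
    sub_mul, div_mul_cancel₀ _ (by positivity)]
  nlinarith [sq_nonneg (s - t)]

lemma abs_exp_sub_exp_le {x y m : ℝ} (hx : x ≤ m) (hy : y ≤ m) :
    |Real.exp x - Real.exp y| ≤ Real.exp m * |x - y| := by
  wlog h : y ≤ x generalizing x y
  · rw [abs_sub_comm, abs_sub_comm x]
    exact this hy hx (le_of_not_ge h)
  rw [abs_of_nonneg (sub_nonneg.mpr (Real.exp_le_exp.mpr h)), abs_of_nonneg (sub_nonneg.mpr h)]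
  have h₁ : Real.exp y = Real.exp x * Real.exp (y - x) := by rw [← Real.exp_add]; ring_nf
  calc Real.exp x - Real.exp y = Real.exp x * (1 - Real.exp (y - x)) := by rw [h₁]; ring
    _ ≤ Real.exp x * (x - y) := by
      refine mul_le_mul_of_nonneg_left ?_ (Real.exp_pos x).le
      linarith [Real.add_one_le_exp (y - x)]
    _ ≤ Real.exp m * (x - y) := by
      have := sub_nonneg.mpr h
      gcongr

/-- Well-posedness of the Bayesian posterior with respect to perturbations of the data:
under (A0)--(A2) and the integrability condition `S_{1,2,r} < ∞`, the map `y ↦ μ^y` is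
Lipschitz from `{‖y‖ < r}` into the Hellinger metric. -/
theorem posterior_lipschitz_in_data
    {U Y : Type*}
    [NormedAddCommGroup U] [NormedSpace ℝ U] [CompleteSpace U]
    [TopologicalSpace.SeparableSpace U] [MeasurableSpace U] [BorelSpace U]
    [NormedAddCommGroup Y] [NormedSpace ℝ Y] [CompleteSpace Y]
    [TopologicalSpace.SeparableSpace Y]
    (μ₀ : Measure U) [IsProbabilityMeasure μ₀]
    (Φ : U → Y → ℝ)
    -- (A0)
    (hA0cont : ∀ u, Continuous (Φ u))
    (hA0meas : ∀ y, Measurable fun u => Φ u y)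
    (hA0bdd : ∀ r > (0 : ℝ), ∃ M₀ : ℝ, ∀ u y, ‖u‖ < r → ‖y‖ < r → |Φ u y| ≤ M₀)
    -- (A1)
    (M₁ : ℝ → ℝ → ℝ)
    (hA1meas : ∀ r > (0 : ℝ), Measurable (M₁ r))
    (hA1 : ∀ r > (0 : ℝ), ∀ u y, ‖y‖ < r → M₁ r ‖u‖ ≤ Φ u y)
    -- (A2)
    (M₂ : ℝ → ℝ → ℝ)
    (hA2meas : ∀ r > (0 : ℝ), Measurable (M₂ r))
    (hA2nonneg : ∀ r > (0 : ℝ), ∀ t : ℝ, 0 ≤ M₂ r t)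
    (hA2 : ∀ r > (0 : ℝ), ∀ u y₁ y₂, ‖y₁‖ < r → ‖y₂‖ < r →
      |Φ u y₁ - Φ u y₂| ≤ Real.exp (M₂ r ‖u‖) * ‖y₁ - y₂‖)
    -- integrability
    (r : ℝ) (hr : 0 < r)
    (hS : Integrable (fun u => Real.exp (2 * M₂ r ‖u‖ - M₁ r ‖u‖)) μ₀) :
    ∃ C : ℝ, ∀ y y' : Y, ‖y‖ < r → ‖y'‖ < r →
      hellingerDist (posteriorMeasure μ₀ Φ y) (posteriorMeasure μ₀ Φ y') ≤ C * ‖y - y'‖ := by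
  have hM₂ : Measurable fun u : U => M₂ r ‖u‖ := (hA2meas r hr).comp measurable_norm
  have hint {f : U → ℝ} (hf : Measurable f) (hle : ∀ u, f u ≤ -M₁ r ‖u‖) :
      Integrable (fun u => Real.exp (f u)) μ₀ := by
    refine hS.mono' hf.exp.aestronglyMeasurable (.of_forall fun u => ?_)
    rw [Real.norm_eq_abs, Real.abs_exp, Real.exp_le_exp]
    linarith [hle u, hA2nonneg r hr ‖u‖]
  have hΦ (y : Y) : Measurable fun u => -Φ u y := (hA0meas y).neg
  have hZi (y : Y) (hy : ‖y‖ < r) : Integrable (fun u => Real.exp (-Φ u y)) μ₀ :=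
    hint (hΦ y) fun u => neg_le_neg (hA1 r hr u y hy)
  have h0 : ‖(0 : Y)‖ < r := by simpa using hr
  let c : ℝ := ∫ u, Real.exp (-Φ u 0 - Real.exp (M₂ r ‖u‖) * r) ∂μ₀
  have hci : Integrable (fun u => Real.exp (-Φ u 0 - Real.exp (M₂ r ‖u‖) * r)) μ₀ := by
    refine hint ((hΦ 0).sub (hM₂.exp.mul_const r)) fun u => ?_
    have : 0 < Real.exp (M₂ r ‖u‖) * r := by positivity
    linarith [hA1 r hr u 0 h0]
  have hc : 0 < c := integral_exp_pos hci
  have hZ (y : Y) (hy : ‖y‖ < r) : c ≤ ∫ u, Real.exp (-Φ u y) ∂μ₀ := by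
    refine integral_mono hci (hZi y hy) fun u => Real.exp_le_exp.mpr ?_
    have h₁ := (le_abs_self _).trans (hA2 r hr u y 0 hy h0)
    have h₂ : Real.exp (M₂ r ‖u‖) * ‖y - 0‖ ≤ Real.exp (M₂ r ‖u‖) * r := by
      rw [sub_zero]
      gcongr
    linarith
  let S : ℝ := ∫ u, Real.exp (2 * M₂ r ‖u‖ - M₁ r ‖u‖) ∂μ₀
  refine ⟨Real.sqrt (S / (4 * c)), fun y y' hy hy' => ?_⟩
  have hsq (y : Y) (u : U) : Real.exp (-Φ u y / 2) ^ 2 = Real.exp (-Φ u y) := by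
    rw [← Real.exp_nat_mul]
    congr 1
    push_cast
    ring
  have hmem (y : Y) (hy : ‖y‖ < r) : MemLp (fun u => Real.exp (-Φ u y / 2)) 2 μ₀ := by
    rw [memLp_two_iff_integrable_sq ((hΦ y).div_const 2).exp.aestronglyMeasurable]
    simpa only [hsq] using hZi y hy
  have hdiff : ∫ u, (Real.exp (-Φ u y / 2) - Real.exp (-Φ u y' / 2)) ^ 2 ∂μ₀ ≤
      S / 4 * ‖y - y'‖ ^ 2 := by
    have hbound (u : U) : (Real.exp (-Φ u y / 2) - Real.exp (-Φ u y' / 2)) ^ 2 ≤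
        Real.exp (2 * M₂ r ‖u‖ - M₁ r ‖u‖) * (‖y - y'‖ ^ 2 / 4) := by
      have h₁ := abs_exp_sub_exp_le (x := -Φ u y / 2) (y := -Φ u y' / 2) (m := -M₁ r ‖u‖ / 2)
        (by linarith [hA1 r hr u y hy]) (by linarith [hA1 r hr u y' hy'])
      have h₂ : |-Φ u y / 2 - -Φ u y' / 2| ≤ Real.exp (M₂ r ‖u‖) * ‖y - y'‖ / 2 := by
        rw [show -Φ u y / 2 - -Φ u y' / 2 = -((Φ u y - Φ u y') / 2) by ring, abs_neg, abs_div,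
          abs_two]
        gcongr
        exact hA2 r hr u y y' hy hy'
      calc (Real.exp (-Φ u y / 2) - Real.exp (-Φ u y' / 2)) ^ 2
          = |Real.exp (-Φ u y / 2) - Real.exp (-Φ u y' / 2)| ^ 2 := (sq_abs _).symm
        _ ≤ (Real.exp (-M₁ r ‖u‖ / 2) * (Real.exp (M₂ r ‖u‖) * ‖y - y'‖ / 2)) ^ 2 := by
          gcongr
          exact h₁.trans (by gcongr)
        _ = Real.exp (2 * M₂ r ‖u‖ - M₁ r ‖u‖) * (‖y - y'‖ ^ 2 / 4) := by
          rw [show 2 * M₂ r ‖u‖ - M₁ r ‖u‖ =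
            (-M₁ r ‖u‖ / 2 + M₂ r ‖u‖) + (-M₁ r ‖u‖ / 2 + M₂ r ‖u‖) by ring,
            Real.exp_add (_ + _), Real.exp_add]
          ring
    calc _ ≤ ∫ u, Real.exp (2 * M₂ r ‖u‖ - M₁ r ‖u‖) * (‖y - y'‖ ^ 2 / 4) ∂μ₀ :=
          integral_mono ((hmem y hy).sub (hmem y' hy')).integrable_sq (hS.mul_const _) hbound
      _ = S / 4 * ‖y - y'‖ ^ 2 := by rw [integral_mul_const]; ring
  have hZ1 := hZ y hy
  have hZ2 := hZ y' hy'
  have hmain := integral_sq_sub_div_sqrt_le (hmem y hy) (hmem y' hy')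
    (by simpa only [hsq] using hc.trans_le hZ1) (by simpa only [hsq] using hc.trans_le hZ2)
  simp only [hsq] at hmain
  have hroot (y : Y) (u : U) (z : ℝ) :
      Real.sqrt (Real.exp (-Φ u y) / z) = Real.exp (-Φ u y / 2) / Real.sqrt z := by
    rw [Real.sqrt_div (Real.exp_pos _).le, ← Real.exp_half]
  unfold posteriorMeasure
  rw [hellingerDist_withDensity_ofReal ((hΦ y).exp.div_const _)
    ((hΦ y').exp.div_const _)
    (fun u => div_nonneg (Real.exp_pos _).le (hc.le.trans hZ1))
    (fun u => div_nonneg (Real.exp_pos _).le (hc.le.trans hZ2))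
    ((hZi y hy).div_const _) ((hZi y' hy').div_const _)]
  simp only [hroot]
  rw [← Real.sqrt_sq (norm_nonneg (y - y')), ← Real.sqrt_mul' _ (sq_nonneg _)]
  refine Real.sqrt_le_sqrt (hmain.trans ?_)
  have hS0 : 0 ≤ S := integral_nonneg fun u => (Real.exp_pos _).le
  have hcc : c ≤ Real.sqrt (∫ v, Real.exp (-Φ v y) ∂μ₀) *
      Real.sqrt (∫ v, Real.exp (-Φ v y') ∂μ₀) := by
    calc c = Real.sqrt c * Real.sqrt c := (Real.mul_self_sqrt hc.le).symm
      _ ≤ _ := by gcongr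
  calc _ ≤ S / 4 * ‖y - y'‖ ^ 2 / c := by gcongr
    _ = S / (4 * c) * ‖y - y'‖ ^ 2 := by field_simp
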